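/- Let q = p be a prime, so that G_A is cyclic of order p generated by the cyclic permutation a = (1 2 … p) of Y (and the action is regular), and let ω ∈ Ω̂ be an r-homogeneous sequence. If p ≥ 3, or if p = 2 and every subsequence of ω of length r contains three homomorphisms whose kernels cover G_B, then the period growth function of G_ω satisfies π_ω(n) ≾ n^{(r−1)·log₂(p)}. -/

import Mathlib

noncomputable section

open Equiv

namespace Spinal

/-- The letter `q` of the alphabet `{1,…,q}` (here `q = m + 2`). -/
def qtop (m : ℕ) : Fin (m + 2) := Fin.last (m + 1)

/-- The letter `1` of the alphabet. -/
def qone (m : ℕ) : Fin (m + 2) := 0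


theorem qone_ne_qtop (m : ℕ) : qone m ≠ qtop m := by
  simp [qone, qtop, Fin.ext_iff]

/-- The action of an alphabet permutation on the first letter of a word. -/
def rootFun (m : ℕ) (a : Equiv.Perm (Fin (m + 2))) :
    List (Fin (m + 2)) → List (Fin (m + 2))
  | [] => []
  | y :: w => a y :: w

theorem rootFun_leftInv (m : ℕ) (a : Equiv.Perm (Fin (m + 2))) (w : List (Fin (m + 2))) :
    rootFun m a.symm (rootFun m a w) = w := by
  cases w <;> simp [rootFun]

/-- The tree automorphism induced by a root permutation. -/
def rootAut (m : ℕ) (a : Equiv.Perm (Fin (m + 2))) : Equiv.Perm (List (Fin (m + 2))) where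
  toFun := rootFun m a
  invFun := rootFun m a.symm
  left_inv w := rootFun_leftInv m a w
  right_inv w := by simpa using rootFun_leftInv m a.symm w

variable {GB : Type*} [Group GB]

/-- The spinal action of `b : G_B` determined by the sequence `ω` of homomorphisms:
at the vertex `q^n 1` the next letter is moved by `ω n b` (0-indexed, so `ω 0` is the
paper's `ω₁`). -/
def spinalFun (m : ℕ) (ω : ℕ → GB →* Equiv.Perm (Fin (m + 2))) (b : GB) :
    ℕ → List (Fin (m + 2)) → List (Fin (m + 2))
  | _, [] => []
  | n, y :: w =>
    if y = qtop m then y :: spinalFun m ω b (n + 1) w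
    else if y = qone m then
      y :: (match w with
            | [] => []
            | z :: w' => ω n b z :: w')
    else y :: w

theorem spinalFun_leftInv (m : ℕ) (ω : ℕ → GB →* Equiv.Perm (Fin (m + 2)))
    (b : GB) (n : ℕ) (w : List (Fin (m + 2))) :
    spinalFun m ω b⁻¹ n (spinalFun m ω b n w) = w := by
  induction w generalizing n with
  | nil => simp [spinalFun]
  | cons y w ih =>
    by_cases h1 : y = qtop m
    · simp [spinalFun, h1, ih]
    · by_cases h2 : y = qone m
      · match w with
        | [] => simp [spinalFun, h1, h2]
        | z :: w' => simp [spinalFun, h1, h2, map_inv, qone_ne_qtop]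
      · simp [spinalFun, h1, h2]

/-- The tree automorphism induced by `b : G_B` via the sequence `ω`. -/
def spinalAut (m : ℕ) (ω : ℕ → GB →* Equiv.Perm (Fin (m + 2))) (b : GB) :
    Equiv.Perm (List (Fin (m + 2))) where
  toFun := spinalFun m ω b 0
  invFun := spinalFun m ω b⁻¹ 0
  left_inv w := spinalFun_leftInv m ω b 0 w
  right_inv w := by simpa using spinalFun_leftInv m ω b⁻¹ 0 w

/-- The canonical generating set `S_ω = A ∪ B_ω` (non-identity induced automorphisms). -/
def genSet (m : ℕ) (GA : Subgroup (Equiv.Perm (Fin (m + 2))))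
    (ω : ℕ → GB →* Equiv.Perm (Fin (m + 2))) : Set (Equiv.Perm (List (Fin (m + 2)))) :=
  ((rootAut m '' (GA : Set (Equiv.Perm (Fin (m + 2))))) ∪
    Set.range fun b : GB => spinalAut m ω b) \ {1}

/-- The spinal group `G_ω`, as a subgroup of the permutation group of the vertex set
of the `(m+2)`-regular rooted tree. -/
def spinalGroup (m : ℕ) (GA : Subgroup (Equiv.Perm (Fin (m + 2))))
    (ω : ℕ → GB →* Equiv.Perm (Fin (m + 2))) : Subgroup (Equiv.Perm (List (Fin (m + 2)))) :=
  Subgroup.closure (genSet m GA ω)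

/-- The defining conditions on the data `(G_A, G_B, ω)` of a spinal group:
`G_A` is a transitive (hence faithful) group of permutations of the alphabet,
every `ω n` is an epimorphism onto `G_A`, and `ω ∈ Ω̂`: from every index on, the kernels
of the remaining homomorphisms cover `G_B` and intersect trivially. -/
structure SpinalData (m : ℕ) (GA : Subgroup (Equiv.Perm (Fin (m + 2))))
    (ω : ℕ → GB →* Equiv.Perm (Fin (m + 2))) : Prop where
  transitive : ∀ i j : Fin (m + 2), ∃ a ∈ GA, a i = j
  range_eq : ∀ n, (ω n).range = GA
  kernels_cover : ∀ i : ℕ, ∀ b : GB, ∃ j, i ≤ j ∧ ω j b = 1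
  kernels_sep : ∀ i : ℕ, ∀ b : GB, (∀ j, i ≤ j → ω j b = 1) → b = 1

/-- Word length of a group element with respect to a set of generators. -/
def wordLength {G : Type*} [Group G] (S : Set G) (g : G) : ℕ :=
  sInf {n | ∃ l : List G, l.length = n ∧ (∀ x ∈ l, x ∈ S) ∧ l.prod = g}

/-- The word growth function `γ_ω` of the spinal group with respect to `S_ω`. -/
def growth (m : ℕ) (GA : Subgroup (Equiv.Perm (Fin (m + 2))))
    (ω : ℕ → GB →* Equiv.Perm (Fin (m + 2))) (n : ℕ) : ℕ :=
  Nat.card {g : Equiv.Perm (List (Fin (m + 2))) //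
    g ∈ spinalGroup m GA ω ∧ wordLength (genSet m GA ω) g ≤ n}

/-- The period growth function `π_ω`: the largest order of an element of word length
at most `n`. -/
def periodGrowth (m : ℕ) (GA : Subgroup (Equiv.Perm (Fin (m + 2))))
    (ω : ℕ → GB →* Equiv.Perm (Fin (m + 2))) (n : ℕ) : ℕ :=
  sSup (orderOf '' {g : Equiv.Perm (List (Fin (m + 2))) |
    g ∈ spinalGroup m GA ω ∧ wordLength (genSet m GA ω) g ≤ n})

/-- Abstract letters for words over `S_ω`: an `A`-letter is (induced by) a permutation
of the alphabet, a `B`-letter is (induced by) an element of `G_B`. -/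
abbrev Letter (m : ℕ) (GB : Type*) := Equiv.Perm (Fin (m + 2)) ⊕ GB

/-- Evaluation of an abstract letter as a tree automorphism. -/
def evalLetter (m : ℕ) (ω : ℕ → GB →* Equiv.Perm (Fin (m + 2))) :
    Letter m GB → Equiv.Perm (List (Fin (m + 2))) :=
  Sum.elim (rootAut m) (spinalAut m ω)

/-- The list of `A`-letters of a word, in order. -/
def aLetters {m : ℕ} {GB : Type*} : List (Letter m GB) → List (Equiv.Perm (Fin (m + 2))) :=
  List.filterMap fun x => match x with
    | Sum.inl a => some a
    | Sum.inr _ => none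

/-- The list of `B`-letters of a word, in order. -/
def bLetters {m : ℕ} {GB : Type*} : List (Letter m GB) → List GB :=
  List.filterMap fun x => match x with
    | Sum.inl _ => none
    | Sum.inr b => some b

/-- A word is reduced if its letters alternate between `A`-letters and `B`-letters and
no letter is the identity. -/
def IsReduced {m : ℕ} (F : List (Letter m GB)) : Prop :=
  List.Chain' (fun x y => x.isLeft ≠ y.isLeft) F ∧
    Sum.inl (1 : Equiv.Perm (Fin (m + 2))) ∉ F ∧ Sum.inr (1 : GB) ∉ F

open scoped Classical in
/-- One step of the (complete, confluent) simple reduction process: prepend a letter to an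
already reduced word and reduce. -/
def reduceStep {m : ℕ} : Letter m GB → List (Letter m GB) → List (Letter m GB)
  | Sum.inl a, [] => if a = 1 then [] else [Sum.inl a]
  | Sum.inr b, [] => if b = 1 then [] else [Sum.inr b]
  | Sum.inl a, Sum.inl a' :: t => if a * a' = 1 then t else Sum.inl (a * a') :: t
  | Sum.inr b, Sum.inr b' :: t => if b * b' = 1 then t else Sum.inr (b * b') :: t
  | Sum.inl a, y :: t => if a = 1 then y :: t else Sum.inl a :: y :: t
  | Sum.inr b, y :: t => if b = 1 then y :: t else Sum.inr b :: y :: t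

/-- The reduced form of a word, obtained by simple reductions. -/
def reduceWord {m : ℕ} (F : List (Letter m GB)) : List (Letter m GB) :=
  F.foldr reduceStep []

open scoped Classical in
/-- The (unreduced) projection of a word, representing an element of the first-level
stabilizer, to the coordinate `i` of the first level: scanning the word from the left
while accumulating the product `g` of the `A`-letters, a `B`-letter `b` contributes the
letter `b` at the coordinate `g(q)` and the letter `ω₁(b)` at the coordinate `g(1)`. -/
def projWord (m : ℕ) (ω0 : GB →* Equiv.Perm (Fin (m + 2))) (i : Fin (m + 2)) :
    List (Letter m GB) → Equiv.Perm (Fin (m + 2)) → List (Letter m GB)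
  | [], _ => []
  | Sum.inl a :: F, g => projWord m ω0 i F (g * a)
  | Sum.inr b :: F, g =>
      ((if g (qtop m) = i then [Sum.inr b] else []) ++
        (if g (qone m) = i then [Sum.inl (ω0 b)] else [])) ++ projWord m ω0 i F g

/-- The list of the `q^r` (reduced) words at level `r` of the depth-`r` decomposition
of a word. -/
def levelWords (m : ℕ) :
    (ℕ → GB →* Equiv.Perm (Fin (m + 2))) → ℕ → List (Letter m GB) →
      List (List (Letter m GB))
  | _, 0, F => [F]
  | ω, r + 1, F =>
      (List.finRange (m + 2)).flatMap fun i =>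
        levelWords m (fun n => ω (n + 1)) r (reduceWord (projWord m (ω 0) i F 1))

/-- `|L_r(F)|`: the total length of level `r` of the depth-`r` decomposition of `F`. -/
def levelLength (m : ℕ) (ω : ℕ → GB →* Equiv.Perm (Fin (m + 2))) (r : ℕ)
    (F : List (Letter m GB)) : ℕ :=
  ((levelWords m ω r F).map List.length).sum

/-- The triangular weight of a letter: `A`-letters have weight `τ₀ = 1 - η^r`; a
`B`-letter `b` has weight `τ_i = η^r + η^(r-i) - 1` where `i` is the smallest (1-based)
index with `ω_i(b) = 1`. -/
def letterWeight (m : ℕ) (ω : ℕ → GB →* Equiv.Perm (Fin (m + 2))) (η : ℝ) (r : ℕ) :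
    Letter m GB → ℝ
  | Sum.inl _ => 1 - η ^ r
  | Sum.inr b => η ^ r + η ^ (r - (sInf {j | ω j b = 1} + 1)) - 1

/-- The total triangular weight of a word. -/
def wordWeight (m : ℕ) (ω : ℕ → GB →* Equiv.Perm (Fin (m + 2))) (η : ℝ) (r : ℕ)
    (F : List (Letter m GB)) : ℝ :=
  (F.map (letterWeight m ω η r)).sum

/-- The weight `∂^τ(g)` of a group element: the least total weight of a word over `S_ω`
representing it. -/
def elemWeight (m : ℕ) (GA : Subgroup (Equiv.Perm (Fin (m + 2))))
    (ω : ℕ → GB →* Equiv.Perm (Fin (m + 2))) (η : ℝ) (r : ℕ)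
    (g : Equiv.Perm (List (Fin (m + 2)))) : ℝ :=
  sInf {x : ℝ | ∃ F : List (Letter m GB),
    (∀ a : Equiv.Perm (Fin (m + 2)), Sum.inl a ∈ F → a ∈ GA) ∧
    (F.map (evalLetter m ω)).prod = g ∧ wordWeight m ω η r F = x}

theorem pow_eq_one_of_dvd {G : Type*} [Monoid G] {g : G} {k l : ℕ} (hkl : k ∣ l)
    (h : g ^ k = 1) : g ^ l = 1 :=
  orderOf_dvd_iff_pow_eq_one.1 ((orderOf_dvd_of_pow_eq_one h).trans hkl)

/-! ### Portraits of words at the first level -/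

theorem spinalFun_mul (m : ℕ) (ω : ℕ → GB →* Equiv.Perm (Fin (m + 2))) (b b' : GB)
    (n : ℕ) (w : List (Fin (m + 2))) :
    spinalFun m ω (b * b') n w = spinalFun m ω b n (spinalFun m ω b' n w) := by
  induction w generalizing n with
  | nil => simp [spinalFun]
  | cons y w ih =>
    by_cases h1 : y = qtop m
    · simp [spinalFun, h1, ih]
    · by_cases h2 : y = qone m
      · match w with
        | [] => simp [spinalFun, h2]
        | z :: w' => simp [spinalFun, h2, qone_ne_qtop]
      · simp [spinalFun, h1, h2]

/-- The action of `G_B` on the tree determined by the sequence `ω` shifted by `n`. -/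
def spinalHom (m : ℕ) (ω : ℕ → GB →* Equiv.Perm (Fin (m + 2))) (n : ℕ) :
    GB →* Equiv.Perm (List (Fin (m + 2))) :=
  MonoidHom.mk'
    (fun b => ⟨spinalFun m ω b n, spinalFun m ω b⁻¹ n, spinalFun_leftInv m ω b n,
      fun w => by simpa using spinalFun_leftInv m ω b⁻¹ n w⟩)
    fun b b' => Equiv.ext fun w => spinalFun_mul m ω b b' n w

theorem spinalHom_apply (m : ℕ) (ω : ℕ → GB →* Equiv.Perm (Fin (m + 2))) (n : ℕ) (b : GB)
    (w : List (Fin (m + 2))) : spinalHom m ω n b w = spinalFun m ω b n w := rfl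

/-- The tree automorphism induced by the translation by `a` of the alphabet `Fin (m + 2)`. -/
def rotAut (m : ℕ) (a : Fin (m + 2)) : Equiv.Perm (List (Fin (m + 2))) :=
  rootAut m (Equiv.addRight a)

theorem rotAut_nil (m : ℕ) (a : Fin (m + 2)) : rotAut m a [] = [] := rfl

theorem rotAut_cons (m : ℕ) (a y : Fin (m + 2)) (w : List (Fin (m + 2))) :
    rotAut m a (y :: w) = (y + a) :: w := rfl

theorem rotAut_zero (m : ℕ) : rotAut m 0 = 1 := by
  ext1 w
  cases w <;> simp [rotAut_nil, rotAut_cons]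

theorem rotAut_add (m : ℕ) (a a' : Fin (m + 2)) :
    rotAut m (a + a') = rotAut m a * rotAut m a' := by
  ext1 w
  cases w <;> simp [rotAut_nil, rotAut_cons, add_assoc, add_comm a a']

theorem rotAut_pow (m : ℕ) (a : Fin (m + 2)) (k : ℕ) : rotAut m a ^ k = rotAut m (k • a) := by
  induction k with
  | zero => simp [rotAut_zero]
  | succ k ih => rw [pow_succ, ih, succ_nsmul, rotAut_add]

theorem rotAut_pow_card (m : ℕ) (a : Fin (m + 2)) : rotAut m a ^ (m + 2) = 1 := by
  have h : (m + 2) • a = 0 := by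
    simpa using card_nsmul_eq_zero (x := a)
  rw [rotAut_pow, h, rotAut_zero]

/-- Evaluation of a word in translations of the alphabet and elements of `G_B`, with
respect to the sequence `ω` shifted by `n`. -/
def evalWord (m : ℕ) (ω : ℕ → GB →* Equiv.Perm (Fin (m + 2))) (n : ℕ)
    (F : List (Fin (m + 2) ⊕ GB)) : Equiv.Perm (List (Fin (m + 2))) :=
  (F.map (Sum.elim (rotAut m) (spinalHom m ω n))).prod

section evalWord

variable (m : ℕ) (ω : ℕ → GB →* Equiv.Perm (Fin (m + 2))) (n : ℕ)

theorem evalWord_nil : evalWord m ω n [] = 1 := rfl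

theorem evalWord_inl (a : Fin (m + 2)) (F : List (Fin (m + 2) ⊕ GB)) :
    evalWord m ω n (Sum.inl a :: F) = rotAut m a * evalWord m ω n F := by
  simp [evalWord]

theorem evalWord_inr (b : GB) (F : List (Fin (m + 2) ⊕ GB)) :
    evalWord m ω n (Sum.inr b :: F) = spinalHom m ω n b * evalWord m ω n F := by
  simp [evalWord]

theorem evalWord_append (F F' : List (Fin (m + 2) ⊕ GB)) :
    evalWord m ω n (F ++ F') = evalWord m ω n F * evalWord m ω n F' := by
  simp [evalWord]

end evalWord

/-- The sum of the values of `f` over the letters of a word. -/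
def letterSum {L M : Type*} [AddCommMonoid M] (f : L → M) (F : List L) : M := (F.map f).sum

section letterSum

variable {L M : Type*} [AddCommMonoid M] (f : L → M)

@[simp] theorem letterSum_nil : letterSum f [] = 0 := rfl

@[simp] theorem letterSum_cons (x : L) (F : List L) :
    letterSum f (x :: F) = f x + letterSum f F := by
  simp [letterSum]

@[simp] theorem letterSum_append (F F' : List L) :
    letterSum f (F ++ F') = letterSum f F + letterSum f F' := by
  simp [letterSum]

theorem letterSum_add (f g : L → M) (F : List L) :
    letterSum (fun x => f x + g x) F = letterSum f F + letterSum g F := by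
  simp [letterSum]

theorem letterSum_le (f g : L → ℕ) (h : ∀ x, f x ≤ g x) (F : List L) :
    letterSum f F ≤ letterSum g F := by
  induction F with
  | nil => simp
  | cons x F ih => simpa using add_le_add (h x) ih

end letterSum

/-- The translation of the first level induced by a word. -/
def rootSum {m : ℕ} (F : List (Fin (m + 2) ⊕ GB)) : Fin (m + 2) :=
  letterSum (Sum.elim id fun _ => 0) F

/-- The contribution of the letter `b ∈ G_B` to the section at the coordinate `y`. -/
def letterSection (m : ℕ) (ω0 : GB →* Equiv.Perm (Fin (m + 2))) (b : GB) (y : Fin (m + 2)) :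
    List (Fin (m + 2) ⊕ GB) :=
  (if y = qtop m then [Sum.inr b] else []) ++
    (if y = qone m then [Sum.inl (ω0 b 0)] else [])

/-- A word representing the section of a word at the coordinate `y`. -/
def wordSection (m : ℕ) (ω0 : GB →* Equiv.Perm (Fin (m + 2))) (y : Fin (m + 2)) :
    List (Fin (m + 2) ⊕ GB) → List (Fin (m + 2) ⊕ GB)
  | [] => []
  | Sum.inl _ :: F => wordSection m ω0 y F
  | Sum.inr b :: F => letterSection m ω0 b (y + rootSum F) ++ wordSection m ω0 y F

theorem wordSection_append (m : ℕ) (ω0 : GB →* Equiv.Perm (Fin (m + 2))) (y : Fin (m + 2))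
    (F F' : List (Fin (m + 2) ⊕ GB)) :
    wordSection m ω0 y (F ++ F') =
      wordSection m ω0 (y + rootSum F') F ++ wordSection m ω0 y F' := by
  induction F with
  | nil => simp [wordSection]
  | cons x F ih =>
    cases x with
    | inl a => simpa [wordSection] using ih
    | inr b => simp [wordSection, ih, rootSum, add_assoc, add_comm]

section translations

variable {m : ℕ} {ω : ℕ → GB →* Equiv.Perm (Fin (m + 2))}

theorem spinalHom_cons (hω : ∀ n b y, ω n b y = y + ω n b 0) (n : ℕ) (b : GB)
    (y : Fin (m + 2)) (w : List (Fin (m + 2))) :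
    spinalHom m ω n b (y :: w) =
      y :: evalWord m ω (n + 1) (letterSection m (ω n) b y) w := by
  have h01 := qone_ne_qtop m
  rw [spinalHom_apply]
  by_cases h1 : y = qtop m
  · subst h1
    simp [spinalFun, letterSection, h01.symm, evalWord_inr, evalWord_nil, spinalHom_apply]
  · by_cases h2 : y = qone m
    · subst h2
      cases w with
      | nil => simp [spinalFun, letterSection, h01, evalWord_inl, evalWord_nil, rotAut_nil]
      | cons z w =>
        simp [spinalFun, letterSection, h01, evalWord_inl, evalWord_nil, rotAut_cons, ← hω]
    · simp [spinalFun, letterSection, h1, h2, evalWord_nil]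

theorem evalWord_apply_nil (n : ℕ) (F : List (Fin (m + 2) ⊕ GB)) :
    evalWord m ω n F [] = [] := by
  induction F with
  | nil => rfl
  | cons x F ih =>
    cases x with
    | inl a => simp [evalWord_inl, ih, rotAut_nil]
    | inr b => simp [evalWord_inr, ih, spinalHom_apply, spinalFun]

theorem evalWord_cons (hω : ∀ n b y, ω n b y = y + ω n b 0) (n : ℕ)
    (F : List (Fin (m + 2) ⊕ GB)) (y : Fin (m + 2)) (w : List (Fin (m + 2))) :
    evalWord m ω n F (y :: w) =
      (y + rootSum F) :: evalWord m ω (n + 1) (wordSection m (ω n) y F) w := by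
  induction F with
  | nil => simp [evalWord_nil, rootSum, wordSection]
  | cons x F ih =>
    cases x with
    | inl a =>
      simp [evalWord_inl, ih, rotAut_cons, rootSum, wordSection, add_left_comm,
        add_comm]
    | inr b =>
      simp only [evalWord_inr, Equiv.Perm.mul_apply, ih, spinalHom_cons hω, wordSection,
        evalWord_append]
      simp [rootSum]

theorem evalWord_pow_eq_one_of_sections (hω : ∀ n b y, ω n b y = y + ω n b 0) {n : ℕ}
    {F : List (Fin (m + 2) ⊕ GB)} (h0 : rootSum F = 0) {k : ℕ}
    (h : ∀ y, evalWord m ω (n + 1) (wordSection m (ω n) y F) ^ k = 1) :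
    evalWord m ω n F ^ k = 1 := by
  have key : ∀ (j : ℕ) (y : Fin (m + 2)) (w : List (Fin (m + 2))),
      (evalWord m ω n F ^ j) (y :: w) =
        y :: (evalWord m ω (n + 1) (wordSection m (ω n) y F) ^ j) w := by
    intro j y w
    induction j with
    | zero => simp
    | succ j ih => rw [pow_succ', Equiv.Perm.mul_apply, ih, evalWord_cons hω, h0, add_zero,
        pow_succ', Equiv.Perm.mul_apply]
  have keyNil : ∀ j : ℕ, (evalWord m ω n F ^ j) [] = [] := by
    intro j
    induction j with
    | zero => rfl
    | succ j ih => rw [pow_succ', Equiv.Perm.mul_apply, ih, evalWord_apply_nil]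
  ext1 w
  cases w with
  | nil => simpa using keyNil k
  | cons y w => rw [key, h]; rfl

end translations

/-- The `k`-th power of a word. -/
def wordPow {L : Type*} (F : List L) : ℕ → List L
  | 0 => []
  | k + 1 => F ++ wordPow F k

theorem evalWord_wordPow (m : ℕ) (ω : ℕ → GB →* Equiv.Perm (Fin (m + 2))) (n : ℕ)
    (F : List (Fin (m + 2) ⊕ GB)) (k : ℕ) :
    evalWord m ω n (wordPow F k) = evalWord m ω n F ^ k := by
  induction k with
  | zero => simp [wordPow, evalWord_nil]
  | succ k ih => rw [wordPow, evalWord_append, ih, pow_succ']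

theorem letterSum_wordPow {L M : Type*} [AddCommMonoid M] (f : L → M) (F : List L) (k : ℕ) :
    letterSum f (wordPow F k) = k • letterSum f F := by
  induction k with
  | zero => simp [wordPow]
  | succ k ih => rw [wordPow, letterSum_append, ih, succ_nsmul']

theorem letterSum_wordSection_wordPow {M : Type*} [AddCommMonoid M] {m : ℕ}
    (ω0 : GB →* Equiv.Perm (Fin (m + 2))) (f : Fin (m + 2) ⊕ GB → M)
    (F : List (Fin (m + 2) ⊕ GB)) (y : Fin (m + 2)) (k : ℕ) :
    letterSum f (wordSection m ω0 y (wordPow F k)) =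
      ∑ t ∈ Finset.range k, letterSum f (wordSection m ω0 (y + t • rootSum F) F) := by
  induction k with
  | zero => simp [wordPow, wordSection]
  | succ k ih =>
    have hk : rootSum (wordPow F k) = k • rootSum F := letterSum_wordPow _ F k
    rw [wordPow, wordSection_append, letterSum_append, ih, Finset.sum_range_succ, add_comm, hk]

theorem sum_letterSum_wordSection {M : Type*} [AddCommMonoid M] {m : ℕ}
    (ω0 : GB →* Equiv.Perm (Fin (m + 2))) (f : Fin (m + 2) ⊕ GB → M)
    (F : List (Fin (m + 2) ⊕ GB)) :
    ∑ y, letterSum f (wordSection m ω0 y F) =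
      letterSum (Sum.elim (fun _ => 0) fun b => f (Sum.inr b) + f (Sum.inl (ω0 b 0))) F := by
  induction F with
  | nil => simp [wordSection]
  | cons x F ih =>
    cases x with
    | inl a => simpa [wordSection] using ih
    | inr b =>
      have h : ∑ y, letterSum f (letterSection m ω0 b (y + rootSum F)) =
          f (Sum.inr b) + f (Sum.inl (ω0 b 0)) := by
        refine (Equiv.sum_comp (Equiv.addRight (rootSum F))
          fun y => letterSum f (letterSection m ω0 b y)).trans ?_
        simp only [letterSection, letterSum_append, Finset.sum_add_distrib]
        congr 1 <;> simp [apply_ite]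
      simp [wordSection, Finset.sum_add_distrib, ih, h]

theorem sum_range_nsmul {M : Type*} [AddCommMonoid M] {m : ℕ} (hp : Nat.Prime (m + 2))
    (f : Fin (m + 2) → M) (y : Fin (m + 2)) {s : Fin (m + 2)} (hs : s ≠ 0) :
    ∑ t ∈ Finset.range (m + 2), f (y + t • s) = ∑ x, f x := by
  have hord : addOrderOf s = m + 2 := by
    have hdvd : addOrderOf s ∣ m + 2 := by simpa using addOrderOf_dvd_card (x := s)
    rcases (Nat.dvd_prime hp).1 hdvd with h | h
    · exact absurd (AddMonoid.addOrderOf_eq_one_iff.1 h) hs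
    · exact h
  rw [Finset.sum_range fun t => f (y + t • s)]
  refine Fintype.sum_bijective (fun t : Fin (m + 2) => y + (t : ℕ) • s) ?_ _ _ fun _ => rfl
  refine Finite.injective_iff_bijective.1 fun t t' h => ?_
  have h' : (t : ℕ) • s = (t' : ℕ) • s := add_left_cancel h
  have := nsmul_injOn_Iio_addOrderOf (x := s) (by simp [hord]) (by simp [hord]) h'
  exact Fin.ext this

theorem letterSum_section_pow {M : Type*} [AddCommMonoid M] {m : ℕ} (hp : Nat.Prime (m + 2))
    (ω0 : GB →* Equiv.Perm (Fin (m + 2))) (f : Fin (m + 2) ⊕ GB → M)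
    {F : List (Fin (m + 2) ⊕ GB)} (hF : rootSum F ≠ 0) (y : Fin (m + 2)) :
    letterSum f (wordSection m ω0 y (wordPow F (m + 2))) =
      letterSum (Sum.elim (fun _ => 0) fun b => f (Sum.inr b) + f (Sum.inl (ω0 b 0))) F := by
  rw [letterSum_wordSection_wordPow,
    sum_range_nsmul hp (fun x => letterSum f (wordSection m ω0 x F)) y hF,
    sum_letterSum_wordSection]

/-! ### Counting letters -/

open scoped Classical in
/-- The number of non-trivial `A`-letters of a word. -/
def aCount {m : ℕ} (F : List (Fin (m + 2) ⊕ GB)) : ℕ :=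
  letterSum (Sum.elim (fun a => if a = 0 then 0 else 1) fun _ => 0) F

open scoped Classical in
/-- The number of non-trivial `B`-letters of a word. -/
def bCount {m : ℕ} (F : List (Fin (m + 2) ⊕ GB)) : ℕ :=
  letterSum (Sum.elim (fun _ => 0) fun b => if b = 1 then 0 else 1) F

/-- The total weight of the `B`-letters of a word. -/
def bWeight {m : ℕ} (v : GB → ℕ) (F : List (Fin (m + 2) ⊕ GB)) : ℕ :=
  letterSum (Sum.elim (fun _ => 0) v) F

/-- The product of the `B`-letters of a word. -/
def bProd {m : ℕ} (F : List (Fin (m + 2) ⊕ GB)) : GB :=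
  (F.map (Sum.elim (fun _ => 1) id)).prod

/-- The translation induced by the images of the `B`-letters under `ω0`. -/
def bSum {m : ℕ} (ω0 : GB →* Equiv.Perm (Fin (m + 2))) (F : List (Fin (m + 2) ⊕ GB)) :
    Fin (m + 2) :=
  letterSum (Sum.elim (fun _ => 0) fun b => ω0 b 0) F

open scoped Classical in
theorem aCount_add_bCount_wordSection_le {m : ℕ} (ω0 : GB →* Equiv.Perm (Fin (m + 2)))
    (y : Fin (m + 2)) (F : List (Fin (m + 2) ⊕ GB)) :
    aCount (wordSection m ω0 y F) + bCount (wordSection m ω0 y F) ≤ bCount F := by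
  induction F with
  | nil => simp [wordSection, aCount, bCount]
  | cons x F ih =>
    cases x with
    | inl a => simpa [wordSection, bCount] using ih
    | inr b =>
      have h : aCount (letterSection m ω0 b (y + rootSum F)) +
          bCount (letterSection m ω0 b (y + rootSum F)) ≤ if b = 1 then 0 else 1 := by
        have h01 := qone_ne_qtop m
        by_cases hb : b = 1
        · subst hb
          simp only [letterSection, aCount, bCount]
          split_ifs <;> simp
        · simp only [letterSection, aCount, bCount]
          split_ifs with h1 h2
          · exact absurd (h2.symm.trans h1) h01
          · simp only [List.append_nil, letterSum_cons, letterSum_nil, Sum.elim_inr]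
            simp [hb]
          · simp only [List.nil_append, letterSum_cons, letterSum_nil, Sum.elim_inl]
            split_ifs <;> simp
          · simp
      simp only [aCount, bCount, wordSection, letterSum_append, letterSum_cons,
        Sum.elim_inr] at ih h ⊢
      omega

theorem evalWord_of_aCount_eq_zero (m : ℕ) (ω : ℕ → GB →* Equiv.Perm (Fin (m + 2))) (n : ℕ)
    {F : List (Fin (m + 2) ⊕ GB)} (h : aCount F = 0) :
    evalWord m ω n F = spinalHom m ω n (bProd F) := by
  induction F with
  | nil => simp [evalWord_nil, bProd]
  | cons x F ih =>
    simp only [aCount, letterSum_cons, Nat.add_eq_zero_iff] at h ih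
    cases x with
    | inl a =>
      have ha : a = 0 := by
        by_contra ha
        simp [ha] at h
      rw [evalWord_inl, ih h.2, ha, rotAut_zero]
      simp [bProd]
    | inr b =>
      rw [evalWord_inr, ih h.2]
      simp [bProd]

theorem evalWord_of_bCount_eq_zero (m : ℕ) (ω : ℕ → GB →* Equiv.Perm (Fin (m + 2))) (n : ℕ)
    {F : List (Fin (m + 2) ⊕ GB)} (h : bCount F = 0) :
    evalWord m ω n F = rotAut m (rootSum F) := by
  induction F with
  | nil => simp [evalWord_nil, rootSum, rotAut_zero]
  | cons x F ih =>
    simp only [bCount, letterSum_cons, Nat.add_eq_zero_iff] at h ih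
    cases x with
    | inl a =>
      rw [evalWord_inl, ih h.2, ← rotAut_add]
      simp [rootSum]
    | inr b =>
      have hb : b = 1 := by
        by_contra hb
        simp [hb] at h
      rw [evalWord_inr, ih h.2, hb]
      simp [rootSum]

theorem exists_append_of_aCount_pos {m : ℕ} {B : Type*} {F : List (Fin (m + 2) ⊕ B)} (h : 0 < aCount F) :
    ∃ (F₁ F₂ : List (Fin (m + 2) ⊕ B)) (a : Fin (m + 2)),
      a ≠ 0 ∧ F = F₁ ++ Sum.inl a :: F₂ := by
  by_contra! hne
  refine h.ne' ?_
  have : ∀ x ∈ F.map (Sum.elim (fun a => if a = 0 then 0 else 1) fun _ => 0), x = 0 := by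
    intro x hx
    obtain ⟨y, hy, rfl⟩ := List.mem_map.1 hx
    cases y with
    | inl a =>
      by_cases ha : a = 0
      · simp [ha]
      · obtain ⟨F₁, F₂, rfl⟩ := List.append_of_mem hy
        exact absurd rfl (hne F₁ F₂ a ha)
    | inr b => rfl
  simpa [aCount, letterSum] using List.sum_eq_zero this

section reduction

variable {m : ℕ} {ω : ℕ → GB →* Equiv.Perm (Fin (m + 2))}

theorem bSum_eq_bProd (hω : ∀ n b y, ω n b y = y + ω n b 0) (k : ℕ)
    (F : List (Fin (m + 2) ⊕ GB)) : bSum (ω k) F = ω k (bProd F) 0 := by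
  induction F with
  | nil => simp [bSum, bProd]
  | cons x F ih =>
    simp only [bSum, bProd] at ih
    cases x with
    | inl a => simpa [bSum, bProd] using ih
    | inr b =>
      simp only [bSum, bProd, letterSum_cons, Sum.elim_inr, ih, List.map_cons, List.prod_cons,
        id_eq, map_mul, Equiv.Perm.mul_apply]
      exact (add_comm _ _).trans (hω k b _).symm

/-- Collecting the `B`-letters between consecutive non-trivial `A`-letters. -/
theorem exists_collected (hω : ∀ n b y, ω n b y = y + ω n b 0) (n : ℕ) {v : GB → ℕ}
    (hv1 : v 1 = 0) (hv : ∀ b b', v (b * b') ≤ v b + v b') (F : List (Fin (m + 2) ⊕ GB)) :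
    ∃ (b : GB) (F' : List (Fin (m + 2) ⊕ GB)),
      evalWord m ω n F = evalWord m ω n (Sum.inr b :: F') ∧ bCount F' ≤ aCount F ∧
      bWeight v (Sum.inr b :: F') ≤ bWeight v F ∧ rootSum (Sum.inr b :: F') = rootSum F ∧
      ∀ k, bSum (ω k) (Sum.inr b :: F') = bSum (ω k) F := by
  induction F with
  | nil =>
    refine ⟨1, [], ?_, ?_, ?_, ?_, ?_⟩ <;>
      simp [evalWord_nil, evalWord_inr, bCount, bWeight, rootSum, bSum, hv1]
  | cons x F ih =>
    obtain ⟨b, F', h1, h2, h3, h4, h5⟩ := ih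
    cases x with
    | inl a =>
      by_cases ha : a = 0
      · refine ⟨b, F', ?_, ?_, ?_, ?_, fun k => ?_⟩
        · rw [evalWord_inl, ha, rotAut_zero, one_mul, h1]
        · simpa [aCount, ha] using h2
        · simpa [bWeight] using h3
        · simpa [rootSum, ha] using h4
        · simpa [bSum] using h5 k
      · refine ⟨1, Sum.inl a :: Sum.inr b :: F', ?_, ?_, ?_, ?_, fun k => ?_⟩
        · rw [evalWord_inl, h1, evalWord_inr _ _ _ 1, evalWord_inl, map_one, one_mul]
        · simp only [aCount, bCount, letterSum_cons, Sum.elim_inl, Sum.elim_inr, ha,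
            if_false] at h2 ⊢
          split_ifs <;> omega
        · simpa [bWeight, hv1] using h3
        · simpa [rootSum] using h4
        · simpa [bSum] using h5 k
    | inr c =>
      refine ⟨c * b, F', ?_, ?_, ?_, ?_, fun k => ?_⟩
      · rw [evalWord_inr, h1, evalWord_inr, evalWord_inr, map_mul, mul_assoc]
      · simpa [aCount] using h2
      · have := hv c b
        simp only [bWeight, letterSum_cons, Sum.elim_inr] at h3 ⊢
        omega
      · simpa [rootSum] using h4
      · have := h5 k
        simp only [bSum, letterSum_cons, Sum.elim_inr, map_mul, Equiv.Perm.mul_apply] at this ⊢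
        rw [hω k c, ← this]
        abel

/-- Cyclic reduction: a word with a non-trivial `A`-letter can be replaced by a conjugate one
with at most as many non-trivial `B`-letters as the original has non-trivial `A`-letters. -/
theorem exists_cyclic_reduction (hω : ∀ n b y, ω n b y = y + ω n b 0) (n : ℕ) {v : GB → ℕ}
    (hv1 : v 1 = 0) (hv : ∀ b b', v (b * b') ≤ v b + v b') {F : List (Fin (m + 2) ⊕ GB)}
    (hF : 0 < aCount F) :
    ∃ F' : List (Fin (m + 2) ⊕ GB), IsConj (evalWord m ω n F') (evalWord m ω n F) ∧
      bCount F' ≤ aCount F ∧ bWeight v F' ≤ bWeight v F ∧ rootSum F' = rootSum F ∧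
      ∀ k, bSum (ω k) F' = bSum (ω k) F := by
  obtain ⟨F₁, F₂, a, ha, rfl⟩ := exists_append_of_aCount_pos hF
  obtain ⟨b, F', h1, h2, h3, h4, h5⟩ := exists_collected hω n hv1 hv (F₂ ++ F₁)
  refine ⟨Sum.inl a :: Sum.inr b :: F', ?_, ?_, ?_, ?_, fun k => ?_⟩
  · rw [evalWord_inl, ← h1, isConj_iff]
    refine ⟨evalWord m ω n F₁, ?_⟩
    simp only [evalWord_append, evalWord_inl]
    group
  · simp only [aCount, bCount, letterSum_cons, letterSum_append, Sum.elim_inl, Sum.elim_inr, ha,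
      if_false] at h2 ⊢
    split_ifs <;> omega
  · simp only [bWeight, letterSum_cons, letterSum_append, Sum.elim_inl] at h3 ⊢
    omega
  · simp only [rootSum, letterSum_cons, letterSum_append, Sum.elim_inl] at h4 ⊢
    rw [h4]
    abel
  · have := h5 k
    simp only [bSum, letterSum_cons, letterSum_append, Sum.elim_inl] at this ⊢
    rw [this]
    abel

end reduction

/-! ### The exponent bound -/

/-- An exponent `e` such that elements of complexity at most `N` have order dividing `p ^ e`. -/
def periodExponent (r N : ℕ) : ℕ :=
  if N = 0 then 1 else Nat.log 2 (2 ^ (r + 1) * N ^ (r - 1))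

theorem le_periodExponent_iff {r N e : ℕ} (hN : N ≠ 0) :
    e ≤ periodExponent r N ↔ 2 ^ e ≤ 2 ^ (r + 1) * N ^ (r - 1) := by
  rw [periodExponent, if_neg hN]
  exact Nat.le_log_iff_pow_le one_lt_two (by positivity)

theorem succ_le_periodExponent (r : ℕ) {N : ℕ} (hN : N ≠ 0) : r + 1 ≤ periodExponent r N :=
  (le_periodExponent_iff hN).2 (Nat.le_mul_of_pos_right _ (by positivity))

theorem periodExponent_add_le {r N d i : ℕ} (hi : i ≤ r) (hN : N ≠ 0)
    (h : 2 ^ i ≤ d ^ (r - 1)) : periodExponent r (N / d) + i ≤ periodExponent r N := by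
  by_cases h0 : N / d = 0
  · have := succ_le_periodExponent r hN
    rw [h0, periodExponent, if_pos rfl]
    omega
  · rw [le_periodExponent_iff hN, pow_add]
    calc 2 ^ periodExponent r (N / d) * 2 ^ i
        ≤ (2 ^ (r + 1) * (N / d) ^ (r - 1)) * d ^ (r - 1) :=
          Nat.mul_le_mul ((le_periodExponent_iff h0).1 le_rfl) h
      _ = 2 ^ (r + 1) * (N / d * d) ^ (r - 1) := by rw [mul_pow, mul_assoc]
      _ ≤ 2 ^ (r + 1) * N ^ (r - 1) := by gcongr; exact Nat.div_mul_le_self N d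

theorem two_pow_le_three_pow_pred {r : ℕ} (hr : 3 ≤ r) : 2 ^ r ≤ 3 ^ (r - 1) := by
  obtain ⟨k, rfl⟩ := Nat.exists_eq_add_of_le hr
  rw [show 3 + k - 1 = 2 + k by omega, pow_add, pow_add]
  exact Nat.mul_le_mul (by norm_num) (Nat.pow_le_pow_left (by norm_num) k)

section killing

variable {m : ℕ}

open scoped Classical in
/-- The weight of `b ∈ G_B` after `i` levels, starting from level `n`: a non-trivial `b` has
weight `2` if it has been in the kernel of one of these `i` homomorphisms, otherwise `1`. -/
def killWeight (ω : ℕ → GB →* Equiv.Perm (Fin (m + 2))) (n i : ℕ) (b : GB) : ℕ :=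
  if b = 1 then 0 else if ∃ k < i, ω (n + k) b = 1 then 2 else 1

variable (ω : ℕ → GB →* Equiv.Perm (Fin (m + 2))) (n i : ℕ)

theorem killWeight_one : killWeight ω n i 1 = 0 := by simp [killWeight]

theorem killWeight_mul_le (b b' : GB) :
    killWeight ω n i (b * b') ≤ killWeight ω n i b + killWeight ω n i b' := by
  by_cases hb : b = 1
  · simp [hb, killWeight_one]
  by_cases hb' : b' = 1
  · simp [hb', killWeight_one]
  simp only [killWeight, hb, hb', if_false]
  split_ifs <;> omega

open scoped Classical in
theorem killWeight_succ_add_le (b : GB) :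
    killWeight ω n (i + 1) b + (if ω (n + i) b 0 = 0 then 0 else 1) ≤
      killWeight ω n i b + if b = 1 then 0 else 1 := by
  by_cases hb : b = 1
  · simp [hb, killWeight_one]
  by_cases h : ∃ k < i, ω (n + k) b = 1
  · have h' : ∃ k < i + 1, ω (n + k) b = 1 := h.imp fun k hk => ⟨hk.1.trans i.lt_succ_self, hk.2⟩
    simp only [killWeight, hb, h, h', if_true, if_false]
    split_ifs <;> omega
  · by_cases h0 : ω (n + i) b 0 = 0
    · simp only [killWeight, hb, h, h0, if_true, if_false]
      split_ifs <;> omega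
    · have h' : ¬ ∃ k < i + 1, ω (n + k) b = 1 := by
        rintro ⟨k, hk, hk1⟩
        rcases Nat.lt_succ_iff_lt_or_eq.1 hk with hk | rfl
        · exact h ⟨k, hk, hk1⟩
        · exact h0 (by rw [hk1]; rfl)
      simp only [killWeight, hb, h, h', h0, if_false, le_refl]

end killing

section period

variable {m : ℕ} {ω : ℕ → GB →* Equiv.Perm (Fin (m + 2))} {r N : ℕ}

open scoped Classical in
/-- Descent through sections of `p`-th powers, until a section with trivial root action is
reached. -/
theorem evalWord_pow_eq_one_of_descent (hp : Nat.Prime (m + 2))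
    (hω : ∀ n b y, ω n b y = y + ω n b 0) (hexp : ∀ b : GB, b ^ (m + 2) = 1) (hr : 3 ≤ r)
    (hhom : ∀ i : ℕ, ∀ b : GB, ∃ j, i ≤ j ∧ j < i + r ∧ ω j b = 1) (hN : N ≠ 0)
    (ih : ∀ N' < N, ∀ (n : ℕ) (F : List (Fin (m + 2) ⊕ GB)), aCount F ≤ N' ∨ bCount F ≤ N' →
      evalWord m ω n F ^ (m + 2) ^ periodExponent r N' = 1)
    (n : ℕ) (β : GB) (d i : ℕ) (hdi : d + i = r) (F : List (Fin (m + 2) ⊕ GB))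
    (hβ : ∀ k, bSum (ω k) F = ω k β 0) (hroot : rootSum F ≠ 0 → ∀ k < i, ω (n + k) β 0 ≠ 0)
    (hbF : bCount F ≤ N) (hw : bWeight (killWeight ω n i) F + bCount F ≤ 2 * N) :
    evalWord m ω (n + i) F ^ (m + 2) ^ (periodExponent r N - i) = 1 := by
  have hE := succ_le_periodExponent r hN
  induction d generalizing i F with
  | zero =>
    obtain rfl : i = r := by omega
    have h0 : rootSum F = 0 := by
      by_contra h0
      obtain ⟨j, hj1, hj2, hj⟩ := hhom n β
      refine hroot h0 (j - n) (by omega) ?_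
      rw [show n + (j - n) = j by omega, hj]
      rfl
    have hkw : bWeight (killWeight ω n i) F = 2 * bCount F := by
      have hk : ∀ b, killWeight ω n i b = if b = 1 then 0 else 2 := by
        intro b
        have : ∃ k < i, ω (n + k) b = 1 := by
          obtain ⟨j, hj1, hj2, hj⟩ := hhom n b
          exact ⟨j - n, by omega, by rwa [show n + (j - n) = j by omega]⟩
        simp [killWeight, this]
      rw [two_mul, bCount, ← letterSum_add, bWeight]
      congr 1
      funext x
      cases x with
      | inl a => rfl
      | inr b => simp only [Sum.elim_inr, hk]; split_ifs <;> rfl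
    have hle := periodExponent_add_le (d := 3) le_rfl hN (two_pow_le_three_pow_pred hr)
    refine evalWord_pow_eq_one_of_sections hω h0 fun y => ?_
    have hc := aCount_add_bCount_wordSection_le (ω (n + i)) y F
    refine pow_eq_one_of_dvd ?_ (ih (N / 3) (by omega) (n + i + 1) _ (by omega))
    exact pow_dvd_pow _ (by omega)
  | succ d ihd =>
    by_cases h0 : rootSum F = 0
    · have hle : periodExponent r (N / 2) + i ≤ periodExponent r N :=
        periodExponent_add_le (by omega) hN (Nat.pow_le_pow_right (by norm_num) (by omega))
      refine evalWord_pow_eq_one_of_sections hω h0 fun y => ?_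
      have hc := aCount_add_bCount_wordSection_le (ω (n + i)) y F
      refine pow_eq_one_of_dvd ?_ (ih (N / 2) (by omega) (n + i + 1) _ (by omega))
      exact pow_dvd_pow _ (by omega)
    · rw [show periodExponent r N - i = (periodExponent r N - (i + 1)) + 1 by omega, pow_succ',
        pow_mul, ← evalWord_wordPow]
      refine evalWord_pow_eq_one_of_sections hω ?_ fun y => ?_
      · rw [rootSum, letterSum_wordPow]
        exact (congrArg (· • rootSum F) (Fintype.card_fin (m + 2)).symm).trans card_nsmul_eq_zero
      set H := wordSection m (ω (n + i)) y (wordPow F (m + 2)) with hH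
      by_cases ha : aCount H = 0
      · rw [evalWord_of_aCount_eq_zero _ _ _ ha, ← map_pow]
        rw [show periodExponent r N - (i + 1) = (periodExponent r N - (i + 1) - 1) + 1 by omega,
          pow_succ', pow_mul, hexp, one_pow, map_one]
      obtain ⟨F', hconj, hb', hw', hr', hs'⟩ := exists_cyclic_reduction hω (n + i + 1)
        (killWeight_one ω n (i + 1)) (killWeight_mul_le ω n (i + 1)) (Nat.pos_of_ne_zero ha)
      have hweight : bWeight (killWeight ω n (i + 1)) H + aCount H ≤
          bWeight (killWeight ω n i) F + bCount F := by
        simp only [bWeight, aCount, bCount, hH, letterSum_section_pow hp _ _ h0,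
          ← letterSum_add]
        refine letterSum_le _ _ (fun x => ?_) F
        cases x with
        | inl a => simp
        | inr b => simpa using killWeight_succ_add_le ω n i b
      have hcount : aCount H ≤ bCount F := by
        simp only [aCount, bCount, hH, letterSum_section_pow hp _ _ h0]
        refine letterSum_le _ _ (fun x => ?_) F
        cases x with
        | inl a => simp
        | inr b =>
          by_cases hb : b = 1
          · simp [hb]
          · simp only [Sum.elim_inr, Sum.elim_inl, hb, if_false]
            split_ifs <;> simp
      have hbs : ∀ k, bSum (ω k) H = bSum (ω k) F := by
        intro k
        simp only [bSum, hH, letterSum_section_pow hp _ _ h0]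
        simp
      have hrs : rootSum H = bSum (ω (n + i)) F := by
        simp only [rootSum, bSum, hH, letterSum_section_pow hp _ _ h0]
        simp
      have := ihd (i + 1) (by omega) F' (fun k => by rw [hs', hbs, hβ]) (fun hne k hk => ?_)
        (by omega) (by omega)
      · have hc := hconj.pow ((m + 2) ^ (periodExponent r N - (i + 1)))
        rw [add_assoc, this, isConj_one_right] at hc
        exact hc
      · rcases Nat.lt_succ_iff_lt_or_eq.1 hk with hk | rfl
        · exact hroot h0 k hk
        · rwa [hr', hrs, hβ] at hne

theorem evalWord_pow_periodExponent (hp : Nat.Prime (m + 2))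
    (hω : ∀ n b y, ω n b y = y + ω n b 0) (hexp : ∀ b : GB, b ^ (m + 2) = 1) (hr : 3 ≤ r)
    (hhom : ∀ i : ℕ, ∀ b : GB, ∃ j, i ≤ j ∧ j < i + r ∧ ω j b = 1) (N n : ℕ)
    (F : List (Fin (m + 2) ⊕ GB)) (hF : aCount F ≤ N ∨ bCount F ≤ N) :
    evalWord m ω n F ^ (m + 2) ^ periodExponent r N = 1 := by
  induction N using Nat.strong_induction_on generalizing n F with
  | _ N ih =>
    have hE : 1 ≤ periodExponent r N := by
      by_cases hN : N = 0
      · simp [periodExponent, hN]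
      · have := succ_le_periodExponent r hN
        omega
    have hpow : evalWord m ω n F ^ (m + 2) = 1 →
        evalWord m ω n F ^ (m + 2) ^ periodExponent r N = 1 :=
      pow_eq_one_of_dvd (dvd_pow_self _ (by omega))
    by_cases ha : aCount F = 0
    · refine hpow ?_
      rw [evalWord_of_aCount_eq_zero _ _ _ ha, ← map_pow, hexp, map_one]
    by_cases hb : bCount F = 0
    · refine hpow ?_
      rw [evalWord_of_bCount_eq_zero _ _ _ hb, rotAut_pow_card]
    have hN : N ≠ 0 := by omega
    have main : ∀ F' : List (Fin (m + 2) ⊕ GB), bCount F' ≤ N →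
        evalWord m ω n F' ^ (m + 2) ^ periodExponent r N = 1 := by
      intro F' hF'
      have hw : bWeight (killWeight ω n 0) F' = bCount F' := by
        simp [bWeight, bCount]
        rfl
      exact evalWord_pow_eq_one_of_descent hp hω hexp hr hhom hN ih n (bProd F') r 0 rfl F'
        (fun k => bSum_eq_bProd hω k F') (by simp) hF' (by omega)
    rcases hF with hF | hF
    · obtain ⟨F', hconj, hb', -⟩ := exists_cyclic_reduction hω n (v := fun _ => 0) rfl
        (fun _ _ => le_rfl) (Nat.pos_of_ne_zero ha)
      have hc := hconj.pow ((m + 2) ^ periodExponent r N)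
      rwa [main F' (hb'.trans hF), isConj_one_right] at hc
    · exact main F hF

end period

theorem bCount_le_length {m : ℕ} (F : List (Fin (m + 2) ⊕ GB)) : bCount F ≤ F.length := by
  induction F with
  | nil => simp [bCount]
  | cons x F ih =>
    cases x with
    | inl a =>
      simp only [bCount, letterSum_cons, Sum.elim_inl, List.length_cons] at ih ⊢
      omega
    | inr b =>
      simp only [bCount, letterSum_cons, Sum.elim_inr, List.length_cons] at ih ⊢
      split_ifs <;> omega

theorem genSet_inv_mem {m : ℕ} {GA : Subgroup (Equiv.Perm (Fin (m + 2)))}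
    {ω : ℕ → GB →* Equiv.Perm (Fin (m + 2))} {x : Equiv.Perm (List (Fin (m + 2)))}
    (hx : x ∈ genSet m GA ω) : x⁻¹ ∈ genSet m GA ω := by
  obtain ⟨hx | ⟨b, rfl⟩, hx1⟩ := hx
  · obtain ⟨a, ha, rfl⟩ := hx
    exact ⟨Or.inl ⟨a⁻¹, inv_mem ha, rfl⟩, by simpa using hx1⟩
  · exact ⟨Or.inr ⟨b⁻¹, map_inv (spinalHom m ω 0) b⟩, by simpa using hx1⟩

theorem exists_list_of_wordLength_le {G : Type*} [Group G] {S : Set G}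
    (hS : ∀ x ∈ S, x⁻¹ ∈ S) {g : G} (hg : g ∈ Subgroup.closure S) {n : ℕ}
    (h : wordLength S g ≤ n) :
    ∃ l : List G, l.length ≤ n ∧ (∀ x ∈ l, x ∈ S) ∧ l.prod = g := by
  have hne : {n | ∃ l : List G, l.length = n ∧ (∀ x ∈ l, x ∈ S) ∧ l.prod = g}.Nonempty := by
    rw [← Subgroup.mem_toSubmonoid, Subgroup.closure_toSubmonoid] at hg
    obtain ⟨l, hl, rfl⟩ := Submonoid.exists_list_of_mem_closure hg
    exact ⟨_, l, rfl, fun x hx => (hl x hx).elim id fun h => by simpa using hS _ h, rfl⟩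
  obtain ⟨l, hl, hlS, hlg⟩ := Nat.sInf_mem hne
  exact ⟨l, hl.trans_le h, hlS, hlg⟩

theorem apply_eq_add_of_mem_zpowers_finRotate {m : ℕ} {σ : Equiv.Perm (Fin (m + 2))}
    (hσ : σ ∈ Subgroup.zpowers (finRotate (m + 2))) (y : Fin (m + 2)) : σ y = y + σ 0 := by
  have hle : Subgroup.zpowers (finRotate (m + 2)) ≤
      { carrier := {σ : Equiv.Perm (Fin (m + 2)) | ∀ y, σ y = y + σ 0}
        one_mem' := by simp
        mul_mem' := fun {σ τ} hσ hτ y => by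
          rw [Equiv.Perm.mul_apply, Equiv.Perm.mul_apply, hτ y, hσ (y + τ 0), hσ (τ 0), add_assoc]
        inv_mem' := fun {σ} hσ y => by
          rw [Equiv.Perm.inv_eq_iff_eq, hσ (y + σ⁻¹ 0), add_assoc, ← hσ]
          simp } := by
    rw [Subgroup.zpowers_le]
    intro y
    simp
  exact hle hσ y

theorem exists_word_of_list {m : ℕ} {GA : Subgroup (Equiv.Perm (Fin (m + 2)))}
    {ω : ℕ → GB →* Equiv.Perm (Fin (m + 2))} (hGA : ∀ a ∈ GA, ∀ y, a y = y + a 0)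
    (l : List (Equiv.Perm (List (Fin (m + 2))))) (hl : ∀ x ∈ l, x ∈ genSet m GA ω) :
    ∃ F : List (Fin (m + 2) ⊕ GB), F.length = l.length ∧ evalWord m ω 0 F = l.prod := by
  induction l with
  | nil => exact ⟨[], rfl, rfl⟩
  | cons x l ih =>
    obtain ⟨F, hF, hFe⟩ := ih fun y hy => hl y (List.mem_cons_of_mem _ hy)
    obtain ⟨⟨a, ha, rfl⟩ | ⟨b, rfl⟩, -⟩ := hl x List.mem_cons_self
    · refine ⟨Sum.inl (a 0) :: F, by simp [hF], ?_⟩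
      rw [evalWord_inl, hFe, List.prod_cons, rotAut]
      congr 2
      ext1 y
      exact (hGA a ha y).symm
    · exact ⟨Sum.inr b :: F, by simp [hF], by rw [evalWord_inr, hFe, List.prod_cons]; rfl⟩

theorem pow_periodExponent_le {r n : ℕ} (hr : 3 ≤ r) (hn : 1 ≤ n) {p : ℝ} (hp : 1 < p) :
    p ^ periodExponent r n ≤ (4 * n : ℝ) ^ (((r : ℝ) - 1) * Real.logb 2 p) := by
  have hlog : 0 ≤ Real.logb 2 p := Real.logb_nonneg (by norm_num) hp.le
  have hE : 2 ^ periodExponent r n ≤ (4 * n) ^ (r - 1) := by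
    refine ((le_periodExponent_iff (by omega)).1 le_rfl).trans ?_
    rw [mul_pow]
    refine Nat.mul_le_mul_right _ ?_
    rw [show 4 = 2 ^ 2 by norm_num, ← pow_mul]
    exact Nat.pow_le_pow_right (by norm_num) (by omega)
  have hE' : (2 : ℝ) ^ periodExponent r n ≤ (4 * n : ℝ) ^ (r - 1) := by exact_mod_cast hE
  calc p ^ periodExponent r n
      = ((2 : ℝ) ^ Real.logb 2 p) ^ periodExponent r n := by
        rw [Real.rpow_logb (by norm_num) (by norm_num) (by linarith)]
    _ = ((2 : ℝ) ^ periodExponent r n) ^ Real.logb 2 p := by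
        rw [← Real.rpow_natCast, ← Real.rpow_mul (by norm_num), mul_comm,
          Real.rpow_mul (by norm_num), Real.rpow_natCast]
    _ ≤ ((4 * n : ℝ) ^ (r - 1)) ^ Real.logb 2 p := by gcongr
    _ = (4 * n : ℝ) ^ (((r : ℝ) - 1) * Real.logb 2 p) := by
        rw [Real.rpow_mul (by positivity), ← Real.rpow_natCast, Nat.cast_sub (by omega),
          Nat.cast_one]

/-- Let `q = p` be prime, with `G_A` cyclic generated by the cycle `(1 2 … p)` (so the
action is regular), and let `ω ∈ Ω̂` be `r`-homogeneous. If `p ≥ 3`, or `p = 2` and every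
length-`r` subsequence of `ω` contains three homomorphisms whose kernels cover `G_B`,
then `π_ω(n) ≾ n^{(r−1)·log₂ p}`. -/
theorem spinalGroup_period_growth_prime (m : ℕ) (hp : Nat.Prime (m + 2))
    (GA : Subgroup (Equiv.Perm (Fin (m + 2))))
    (hGA : GA = Subgroup.zpowers (finRotate (m + 2)))
    {GB : Type*} [Group GB] [Finite GB] (ω : ℕ → GB →* Equiv.Perm (Fin (m + 2)))
    (hdata : SpinalData m GA ω) (r : ℕ) (hr : 3 ≤ r)
    (hhom : ∀ i : ℕ, ∀ b : GB, ∃ j, i ≤ j ∧ j < i + r ∧ ω j b = 1)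
    (hcase : 1 ≤ m ∨ (m = 0 ∧ ∀ i : ℕ, ∃ j₁ j₂ j₃ : ℕ,
      i ≤ j₁ ∧ j₁ < j₂ ∧ j₂ < j₃ ∧ j₃ < i + r ∧
        ∀ b : GB, ω j₁ b = 1 ∨ ω j₂ b = 1 ∨ ω j₃ b = 1)) :
    ∃ C : ℝ, 0 < C ∧ ∀ n : ℕ, 1 ≤ n →
      (periodGrowth m GA ω n : ℝ) ≤
        (C * n) ^ (((r : ℝ) - 1) * Real.logb 2 (m + 2)) := by
  have hGA' : ∀ a ∈ GA, ∀ y, a y = y + a 0 := fun a ha y =>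
    apply_eq_add_of_mem_zpowers_finRotate (hGA ▸ ha) y
  have hω : ∀ n b y, ω n b y = y + ω n b 0 := fun n b =>
    hGA' _ (hdata.range_eq n ▸ ⟨b, rfl⟩)
  have hexp : ∀ b : GB, b ^ (m + 2) = 1 := by
    refine fun b => hdata.kernels_sep 0 _ fun j _ => ?_
    have hpow : ∀ k : ℕ, ∀ y, ((ω j b) ^ k) y = y + k • ω j b 0 := by
      intro k y
      induction k with
      | zero => simp
      | succ k ih => rw [pow_succ', Equiv.Perm.mul_apply, ih, hω, add_assoc, succ_nsmul]
    have h0 : (m + 2) • ω j b 0 = 0 := by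
      simpa using card_nsmul_eq_zero (x := ω j b 0)
    ext1 y
    rw [map_pow, hpow, h0, add_zero]
    rfl
  refine ⟨4, by norm_num, fun n hn => ?_⟩
  have hle : periodGrowth m GA ω n ≤ (m + 2) ^ periodExponent r n := by
    refine csSup_le' ?_
    rintro _ ⟨g, ⟨hg, hgn⟩, rfl⟩
    obtain ⟨l, hln, hlS, rfl⟩ := exists_list_of_wordLength_le (fun _ => genSet_inv_mem) hg hgn
    obtain ⟨F, hFl, hF⟩ := exists_word_of_list hGA' l hlS
    refine Nat.le_of_dvd (by positivity) (orderOf_dvd_of_pow_eq_one ?_)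
    rw [← hF]
    exact evalWord_pow_periodExponent hp hω hexp hr hhom n 0 F
      (Or.inr ((bCount_le_length F).trans (hFl.trans_le hln)))
  calc (periodGrowth m GA ω n : ℝ) ≤ ((m : ℝ) + 2) ^ periodExponent r n := by exact_mod_cast hle
    _ ≤ _ := pow_periodExponent_le hr hn (by linarith [(Nat.cast_nonneg m : (0 : ℝ) ≤ m)])
end Spinal
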